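/- For every z in the upper half-plane (Im z > 0), 𝓕(−z) − 𝓕(z) = 2πi·( (1/4)·log(z/i) + πiz/12 + ∑_{n=1}^∞ log(1 − e^{2πinz}) ), where log denotes the principal branch of the complex logarithm. (The right-hand side is 2πi·log((z/i)^{1/4}·η(z)) with η the Dedekind eta function, for the branch of the logarithm that is real on the positive imaginary axis.) -/

import Mathlib

open Complex

/-- The complex digamma function ψ = Γ′/Γ. -/
noncomputable def cdigamma (z : ℂ) : ℂ := deriv Complex.Gamma z / Complex.Gamma z

/-- The Herglotz function F(z) = ∑_{n≥1} (ψ(nz) − log(nz))/n on the cut plane,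
with the principal branch of the logarithm. -/
noncomputable def cherglotzF (z : ℂ) : ℂ :=
  ∑' n : ℕ, (cdigamma (((n : ℂ) + 1) * z) - Complex.log (((n : ℂ) + 1) * z)) / ((n : ℂ) + 1)

/-- The modified Herglotz function 𝓕(z) = F(z) − F(1) + (π²/12)(z − 2 + 1/z) − (log z)²/4. -/
noncomputable def cmathcalF (z : ℂ) : ℂ :=
  cherglotzF z - cherglotzF 1 + ((Real.pi : ℂ) ^ 2 / 12) * (z - 2 + 1 / z)
    - Complex.log z ^ 2 / 4

open Filter Topology

/-- Pointwise convergence and a uniform bound on a circle imply convergence of the derivatives at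
its center. -/
lemma tendsto_deriv_of_bounded_on_sphere {f : ℕ → ℂ → ℂ} {g : ℂ → ℂ} {c : ℂ} {R M : ℝ}
    (hR : 0 < R) (hf : ∀ᶠ n in atTop, DifferentiableOn ℂ (f n) (Metric.closedBall c R))
    (hg : DifferentiableOn ℂ g (Metric.closedBall c R))
    (hM : ∀ᶠ n in atTop, ∀ s ∈ Metric.sphere c R, ‖f n s‖ ≤ M)
    (hlim : ∀ s ∈ Metric.sphere c R, Tendsto (fun n => f n s) atTop (𝓝 (g s))) :
    Tendsto (fun n => deriv (f n) c) atTop (𝓝 (deriv g c)) := by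
  have hmem : ∀ θ : ℝ, circleMap c R θ ∈ Metric.sphere c R := circleMap_mem_sphere c hR.le
  have hint : Tendsto (fun n => ∮ s in C(c, R), (1 / (s - c) ^ 2) • f n s) atTop
      (𝓝 (∮ s in C(c, R), (1 / (s - c) ^ 2) • g s)) := by
    unfold circleIntegral
    refine intervalIntegral.tendsto_integral_filter_of_dominated_convergence
      (fun _ => R * (1 / R ^ 2 * M)) ?_ ?_ intervalIntegrable_const ?_
    · filter_upwards [hf] with n hn
      have h1 : Continuous fun θ : ℝ => f n (circleMap c R θ) :=
        hn.continuousOn.comp_continuous (continuous_circleMap c R)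
          fun θ => Metric.sphere_subset_closedBall (hmem θ)
      have h2 : Continuous fun θ : ℝ => (circleMap c R θ - c) ^ 2 :=
        ((continuous_circleMap c R).sub continuous_const).pow 2
      have h3 : ∀ θ : ℝ, (circleMap c R θ - c) ^ 2 ≠ 0 := fun θ =>
        pow_ne_zero 2 (sub_ne_zero.mpr (circleMap_ne_center hR.ne'))
      have h4 : Continuous fun θ : ℝ => deriv (circleMap c R) θ := by
        simp only [deriv_circleMap]
        exact (continuous_circleMap 0 R).mul continuous_const
      exact (h4.smul ((continuous_const.div h2 h3).smul h1)).aestronglyMeasurable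
    · filter_upwards [hM] with n hn
      refine Eventually.of_forall fun θ _ => ?_
      have h5 : ‖circleMap c R θ - c‖ = R := by simpa [dist_eq_norm] using hmem θ
      rw [norm_smul, norm_smul, deriv_circleMap, norm_mul, norm_I, mul_one, norm_div, norm_pow, h5,
        norm_one, norm_circleMap_zero, abs_of_pos hR]
      gcongr
      exact hn _ (hmem θ)
    · refine Eventually.of_forall fun θ _ => ?_
      exact ((hlim _ (hmem θ)).const_smul _).const_smul _
  have hpi : (2 * Real.pi * I : ℂ) ≠ 0 := two_pi_I_ne_zero
  rw [hg.deriv_eq_smul_circleIntegral hR] at hint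
  have := hint.const_smul (2 * Real.pi * I : ℂ)⁻¹
  rw [inv_smul_smul₀ hpi] at this
  refine this.congr' ?_
  filter_upwards [hf] with n hn
  rw [hn.deriv_eq_smul_circleIntegral hR, inv_smul_smul₀ hpi]

lemma norm_GammaSeq_le {a b : ℝ} (ha : 0 < a) {s : ℂ} (has : a ≤ s.re) (hsb : s.re ≤ b)
    {n : ℕ} (hn : n ≠ 0) : ‖GammaSeq s n‖ ≤ Real.Gamma a + Real.Gamma b := by
  have hs : 0 < s.re := ha.trans_le has
  have hb : 0 < b := hs.trans_le hsb
  have hIa := Real.GammaIntegral_convergent ha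
  have hIb := Real.GammaIntegral_convergent hb
  have hI := hIa.add hIb
  have h0n : (0 : ℝ) ≤ n := n.cast_nonneg
  rw [GammaSeq_eq_approx_Gamma_integral hs hn, Real.Gamma_eq_integral ha,
    Real.Gamma_eq_integral hb, ← MeasureTheory.integral_add hIa hIb]
  refine (intervalIntegral.norm_integral_le_of_norm_le h0n
    (g := fun x => Real.exp (-x) * x ^ (a - 1) + Real.exp (-x) * x ^ (b - 1)) ?_ ?_).trans ?_
  · refine Eventually.of_forall fun x hx => ?_
    have hx0 : 0 < x := hx.1
    have hxn : 0 ≤ 1 - x / n := sub_nonneg.mpr (div_le_one_of_le₀ hx.2 h0n)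
    rw [norm_mul, norm_real, Real.norm_of_nonneg (pow_nonneg hxn n),
      norm_cpow_eq_rpow_re_of_pos hx0, sub_re, one_re, ← mul_add]
    refine mul_le_mul (Real.one_sub_div_pow_le_exp_neg hx.2) ?_ (by positivity) (by positivity)
    rcases le_total x 1 with h | h
    · have := Real.rpow_le_rpow_of_exponent_ge hx0 h (sub_le_sub_right has 1)
      have : 0 ≤ x ^ (b - 1) := by positivity
      linarith
    · have := Real.rpow_le_rpow_of_exponent_le h (sub_le_sub_right hsb 1)
      have : 0 ≤ x ^ (a - 1) := by positivity
      linarith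
  · rw [intervalIntegrable_iff_integrableOn_Ioc_of_le h0n]
    exact hI.mono_set Set.Ioc_subset_Ioi_self
  · rw [intervalIntegral.integral_of_le h0n]
    refine MeasureTheory.setIntegral_mono_set hI ?_ Set.Ioc_subset_Ioi_self.eventuallyLE
    refine (MeasureTheory.ae_restrict_iff' measurableSet_Ioi).mpr
      (Eventually.of_forall fun x hx => ?_)
    have hx0 : 0 < x := hx
    simp only [Pi.zero_apply]
    positivity

lemma ne_neg_nat_of_re_pos {s : ℂ} (hs : 0 < s.re) (m : ℕ) : s ≠ -m := by
  rintro rfl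
  simp only [neg_re, natCast_re] at hs
  linarith [m.cast_nonneg (α := ℝ)]

lemma add_nat_ne_zero_of_re_pos {s : ℂ} (hs : 0 < s.re) (m : ℕ) : s + m ≠ 0 := fun h =>
  ne_neg_nat_of_re_pos hs m (eq_neg_of_add_eq_zero_left h)

lemma differentiableAt_GammaSeq {s : ℂ} (hs : 0 < s.re) {n : ℕ} (hn : n ≠ 0) :
    DifferentiableAt ℂ (fun s => GammaSeq s n) s := by
  unfold GammaSeq
  have hn' : (n : ℂ) ≠ 0 := Nat.cast_ne_zero.mpr hn
  refine DifferentiableAt.div ?_ (by fun_prop) ?_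
  · exact (differentiableAt_id.const_cpow (Or.inl hn')).mul_const _
  · exact Finset.prod_ne_zero_iff.mpr fun j _ => add_nat_ne_zero_of_re_pos hs j

lemma GammaSeq_ne_zero {s : ℂ} (hs : 0 < s.re) {n : ℕ} (hn : n ≠ 0) : GammaSeq s n ≠ 0 := by
  unfold GammaSeq
  have hn' : (n : ℂ) ≠ 0 := Nat.cast_ne_zero.mpr hn
  refine div_ne_zero (mul_ne_zero (by simp [cpow_eq_zero_iff, hn']) ?_) ?_
  · exact_mod_cast n.factorial_ne_zero
  · exact Finset.prod_ne_zero_iff.mpr fun j _ => add_nat_ne_zero_of_re_pos hs j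

lemma logDeriv_GammaSeq {s : ℂ} (hs : 0 < s.re) {n : ℕ} (hn : n ≠ 0) :
    logDeriv (fun s => GammaSeq s n) s
      = Complex.log n - ∑ j ∈ Finset.range (n + 1), 1 / (s + j) := by
  have hn' : (n : ℂ) ≠ 0 := Nat.cast_ne_zero.mpr hn
  have hne := GammaSeq_ne_zero hs hn
  unfold GammaSeq at hne ⊢
  rw [div_ne_zero_iff] at hne
  have hd : DifferentiableAt ℂ (fun s : ℂ => (n : ℂ) ^ s) s :=
    differentiableAt_id.const_cpow (Or.inl hn')
  rw [logDeriv_div (f := fun s : ℂ => (n : ℂ) ^ s * n.factorial)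
      (g := fun s : ℂ => ∏ j ∈ Finset.range (n + 1), (s + j)) s hne.1 hne.2 (hd.mul_const _)
      (by fun_prop),
    logDeriv_prod (fun j _ => add_nat_ne_zero_of_re_pos hs j) (fun j _ => by fun_prop)]
  congr 1
  · rw [logDeriv_mul_const s _ (Nat.cast_ne_zero.mpr n.factorial_ne_zero), logDeriv_apply]
    have h0 : (n : ℂ) ^ s ≠ 0 := by simp [cpow_eq_zero_iff, hn']
    have := ((hasDerivAt_id s).const_cpow (c := (n : ℂ)) (Or.inl hn')).deriv
    simp only [id] at this
    rw [this]
    field_simp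
  · refine Finset.sum_congr rfl fun j _ => ?_
    simp [logDeriv_apply]

/-- Euler's limit formula for the digamma function. -/
lemma tendsto_cdigamma {s : ℂ} (hs : 0 < s.re) :
    Tendsto (fun n : ℕ => Complex.log n - ∑ j ∈ Finset.range (n + 1), 1 / (s + j)) atTop
      (𝓝 (cdigamma s)) := by
  have hball : ∀ w ∈ Metric.closedBall s (s.re / 2), s.re / 2 ≤ w.re ∧ w.re ≤ 2 * s.re := by
    intro w hw
    rw [Metric.mem_closedBall, dist_eq_norm] at hw
    have := abs_le.mp ((abs_re_le_norm (w - s)).trans hw)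
    rw [sub_re] at this
    constructor <;> linarith [this.1, this.2]
  have hpos : ∀ w ∈ Metric.closedBall s (s.re / 2), 0 < w.re := fun w hw =>
    (half_pos hs).trans_le (hball w hw).1
  have hderiv : Tendsto (fun n => deriv (fun s => GammaSeq s n) s) atTop (𝓝 (deriv Gamma s)) := by
    refine tendsto_deriv_of_bounded_on_sphere (half_pos hs)
      (M := Real.Gamma (s.re / 2) + Real.Gamma (2 * s.re)) ?_ ?_ ?_ ?_
    · filter_upwards [eventually_ne_atTop 0] with n hn w hw
      exact (differentiableAt_GammaSeq (hpos w hw) hn).differentiableWithinAt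
    · intro w hw
      exact (differentiableAt_Gamma w (ne_neg_nat_of_re_pos (hpos w hw))).differentiableWithinAt
    · filter_upwards [eventually_ne_atTop 0] with n hn w hw
      have := hball w (Metric.sphere_subset_closedBall hw)
      exact norm_GammaSeq_le (half_pos hs) this.1 this.2 hn
    · exact fun w _ => GammaSeq_tendsto_Gamma w
  refine (hderiv.div (GammaSeq_tendsto_Gamma s) (Gamma_ne_zero_of_re_pos hs)).congr' ?_
  filter_upwards [eventually_ne_atTop 0] with n hn
  rw [← logDeriv_GammaSeq hs hn, logDeriv_apply]
  rfl

lemma log_add_one_sub_log {w : ℂ} (hw : 0 ≤ w.re) (hw0 : w ≠ 0) :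
    Complex.log (w + 1) - Complex.log w = Complex.log (1 + 1 / w) := by
  have hre : 0 < (1 + 1 / w).re := by
    rw [add_re, one_re, one_div, inv_re]
    have : 0 ≤ w.re / normSq w := div_nonneg hw (normSq_nonneg w)
    linarith
  have hne : 1 + 1 / w ≠ 0 := fun h => by
    rw [h, zero_re] at hre
    exact hre.false
  have h1 := abs_le.mp (abs_arg_le_pi_div_two_iff.mpr hw)
  have h2 := abs_lt.mp (abs_arg_lt_pi_div_two_iff.mpr (Or.inl hre))
  have h3 : w + 1 = w * (1 + 1 / w) := by field_simp
  rw [h3, Complex.log_mul hw0 hne ⟨by linarith, by linarith⟩]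
  ring

lemma add_norm_sq_le {w : ℂ} (hw : 0 ≤ w.re) (k : ℕ) :
    (‖w‖ + k) ^ 2 ≤ 2 * ‖w + k‖ ^ 2 := by
  rw [← normSq_eq_norm_sq (w + k), normSq_apply]
  have h := normSq_eq_norm_sq w
  rw [normSq_apply] at h
  have hk : (0 : ℝ) ≤ k := k.cast_nonneg
  simp only [add_re, add_im, natCast_re, natCast_im]
  nlinarith [sq_nonneg (‖w‖ - k), mul_nonneg hw hk]

lemma norm_log_increment_le {w : ℂ} (hw : 0 ≤ w.re) (hn : 2 ≤ ‖w‖) (k : ℕ) :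
    ‖Complex.log (w + k + 1) - Complex.log (w + k) - 1 / (w + k)‖
      ≤ 2 * (1 / (‖w‖ + k - 1) - 1 / (‖w‖ + k)) := by
  have hk : (0 : ℝ) ≤ k := k.cast_nonneg
  have hsq := add_norm_sq_le hw k
  have hwk : ‖w‖ ≤ ‖w + k‖ := by
    refine abs_le_of_sq_le_sq' ?_ (norm_nonneg _) |>.2
    rw [← normSq_eq_norm_sq, ← normSq_eq_norm_sq, normSq_apply, normSq_apply]
    simp only [add_re, add_im, natCast_re, natCast_im]
    nlinarith [mul_nonneg hw hk]
  have h2 : 2 ≤ ‖w + k‖ := hn.trans hwk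
  have hne : w + k ≠ 0 := norm_pos_iff.mp (by linarith)
  rw [log_add_one_sub_log (by simp only [add_re, natCast_re]; positivity) hne]
  have hinv : ‖1 / (w + k)‖ = 1 / ‖w + k‖ := by rw [norm_div, norm_one]
  have hhalf : ‖1 / (w + k)‖ ≤ 1 / 2 := by
    rw [hinv]; exact one_div_le_one_div_of_le two_pos h2
  refine (norm_log_one_add_sub_self_le (by linarith)).trans ?_
  have h3 : (1 - ‖1 / (w + k)‖)⁻¹ ≤ 2 := by
    rw [inv_le_comm₀ (by linarith) two_pos]; linarith
  calc ‖1 / (w + k)‖ ^ 2 * (1 - ‖1 / (w + k)‖)⁻¹ / 2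
      ≤ ‖1 / (w + k)‖ ^ 2 * 2 / 2 := by gcongr
    _ = 1 / ‖w + k‖ ^ 2 := by rw [hinv]; field_simp
    _ ≤ 2 / (‖w‖ + k) ^ 2 := by
        rw [div_le_div_iff₀ (by positivity) (by positivity)]; linarith
    _ ≤ 2 * (1 / (‖w‖ + k - 1) - 1 / (‖w‖ + k)) := by
        rw [div_sub_div _ _ (by linarith) (by linarith), ← mul_div_assoc,
          div_le_div_iff₀ (by nlinarith) (by nlinarith)]
        nlinarith

lemma tendsto_log_add_sub_log (w : ℂ) :
    Tendsto (fun n : ℕ => Complex.log n - Complex.log (w + (n + 1 : ℕ))) atTop (𝓝 0) := by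
  have h1 : Tendsto (fun n : ℕ => 1 + (w + 1) / (n : ℂ)) atTop (𝓝 1) := by
    simpa using (tendsto_const_div_atTop_nhds_zero_nat (w + 1)).const_add 1
  have h2 := (h1.clog one_mem_slitPlane).neg
  rw [Complex.log_one, neg_zero] at h2
  refine h2.congr' ?_
  filter_upwards [eventually_ne_atTop 0, h1.eventually_ne one_ne_zero] with n hn hne
  have hn' : (n : ℂ) ≠ 0 := Nat.cast_ne_zero.mpr hn
  have h3 : w + (n + 1 : ℕ) = ((n : ℝ) : ℂ) * (1 + (w + 1) / n) := by
    push_cast; field_simp; ring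
  rw [h3, Complex.log_ofReal_mul (by positivity) hne, ← natCast_log]
  push_cast
  ring

lemma norm_cdigamma_sub_log_le_of_re_pos {w : ℂ} (hw : 0 < w.re) (hn : 2 ≤ ‖w‖) :
    ‖cdigamma w - Complex.log w‖ ≤ 4 / ‖w‖ := by
  have hlim := ((tendsto_cdigamma hw).sub_const (Complex.log w)).sub (tendsto_log_add_sub_log w)
  rw [sub_zero] at hlim
  refine le_of_tendsto hlim.norm (Eventually.of_forall fun n => ?_)
  have htel : Complex.log n - ∑ j ∈ Finset.range (n + 1), 1 / (w + j) - Complex.log w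
        - (Complex.log n - Complex.log (w + (n + 1 : ℕ)))
      = ∑ j ∈ Finset.range (n + 1),
          (Complex.log (w + j + 1) - Complex.log (w + j) - 1 / (w + j)) := by
    have := Finset.sum_range_sub (fun j : ℕ => Complex.log (w + j)) (n + 1)
    rw [Finset.sum_sub_distrib]
    simp only [Nat.cast_add, Nat.cast_one, Nat.cast_zero, add_zero, ← add_assoc] at this ⊢
    rw [this]; ring
  rw [htel]
  have htel2 := Finset.sum_range_sub' (fun j : ℕ => 1 / (‖w‖ + j - 1)) (n + 1)
  calc _ ≤ ∑ j ∈ Finset.range (n + 1), 2 * (1 / (‖w‖ + j - 1) - 1 / (‖w‖ + j)) :=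
        norm_sum_le_of_le _ fun j _ => norm_log_increment_le hw.le hn j
    _ = 2 * (1 / (‖w‖ - 1) - 1 / (‖w‖ + (n + 1 : ℕ) - 1)) := by
        rw [← Finset.mul_sum]
        simp only [Nat.cast_zero, add_zero] at htel2
        rw [← htel2]
        simp [← add_assoc]
    _ ≤ 2 * (1 / (‖w‖ - 1)) := by
        have : 0 ≤ 1 / (‖w‖ + (n + 1 : ℕ) - 1) := by
          apply one_div_nonneg.mpr; push_cast; linarith [n.cast_nonneg (α := ℝ)]
        linarith
    _ ≤ 4 / ‖w‖ := by
        rw [← mul_div_assoc, mul_one, div_le_div_iff₀ (by linarith) (by linarith)]; linarith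

lemma norm_cdigamma_sub_log_le {w : ℂ} (hw : 0 ≤ w.re) (hn : 2 ≤ ‖w‖) :
    ‖cdigamma w - Complex.log w‖ ≤ 7 / ‖w‖ := by
  have hw0 : w ≠ 0 := norm_pos_iff.mp (by linarith)
  have hpos : 0 < ‖w‖ := by linarith
  have hadd : cdigamma (w + 1) = cdigamma w + w⁻¹ := by
    refine digamma_apply_add_one w ?_
    rintro m rfl
    simp only [neg_re, natCast_re] at hw
    have hm : (m : ℝ) = 0 := le_antisymm (by linarith) m.cast_nonneg
    exact hw0 (by simp [Nat.cast_eq_zero.mp hm])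
  have hlog := log_add_one_sub_log hw hw0
  have hwk : ‖w‖ ≤ ‖w + 1‖ := by
    refine abs_le_of_sq_le_sq' ?_ (norm_nonneg _) |>.2
    rw [← normSq_eq_norm_sq, ← normSq_eq_norm_sq, normSq_apply, normSq_apply]
    simp only [add_re, add_im, one_re, one_im]
    nlinarith
  have hinv : ‖1 / w‖ = 1 / ‖w‖ := by rw [norm_div, norm_one]
  have h1 : ‖cdigamma (w + 1) - Complex.log (w + 1)‖ ≤ 4 / ‖w‖ :=
    (norm_cdigamma_sub_log_le_of_re_pos (by simp only [add_re, one_re]; linarith)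
      (hn.trans hwk)).trans (div_le_div_of_nonneg_left (by norm_num) hpos hwk)
  have h2 : ‖Complex.log (1 + 1 / w)‖ ≤ 3 / 2 * ‖1 / w‖ := by
    refine norm_log_one_add_half_le_self ?_
    rw [hinv]; exact one_div_le_one_div_of_le two_pos hn
  have heq : cdigamma w - Complex.log w
      = cdigamma (w + 1) - Complex.log (w + 1) + Complex.log (1 + 1 / w) - 1 / w := by
    rw [hadd, ← hlog, one_div]; ring
  rw [heq]
  refine (norm_sub_le _ _).trans ?_
  refine (add_le_add_left ((norm_add_le _ _).trans (add_le_add h1 h2)) _).trans ?_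
  rw [hinv, ← sub_nonneg]
  have : 7 / ‖w‖ - (4 / ‖w‖ + 3 / 2 * (1 / ‖w‖) + 1 / ‖w‖) = 1 / 2 * (1 / ‖w‖) := by ring
  rw [this]
  positivity

lemma summable_cherglotzF_of_re_nonneg {z : ℂ} (hz : 0 ≤ z.re) (hz0 : z ≠ 0) :
    Summable fun n : ℕ => (cdigamma (((n : ℂ) + 1) * z) - Complex.log (((n : ℂ) + 1) * z))
      / ((n : ℂ) + 1) := by
  have hpos : 0 < ‖z‖ := norm_pos_iff.mpr hz0
  have hs : Summable fun n : ℕ => 7 / ‖z‖ * (1 / ((n : ℝ) + 1) ^ 2) := by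
    have := (summable_nat_add_iff 1).mpr (Real.summable_one_div_nat_pow.mpr one_lt_two)
    exact (by simpa using this : Summable fun n : ℕ => (1 / ((n : ℝ) + 1) ^ 2)).mul_left _
  refine Summable.of_norm_bounded_eventually_nat hs ?_
  have hlarge : Tendsto (fun n : ℕ => ((n : ℝ) + 1) * ‖z‖) atTop atTop :=
    (tendsto_atTop_add_const_right _ 1 tendsto_natCast_atTop_atTop).atTop_mul_const hpos
  filter_upwards [hlarge.eventually_ge_atTop 2] with n hn
  have hcast : (n : ℂ) + 1 = ((n + 1 : ℝ) : ℂ) := by push_cast; rfl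
  have hn1 : (0 : ℝ) < n + 1 := by positivity
  have hnorm : ‖(n : ℂ) + 1‖ = n + 1 := by rw [hcast, norm_real, Real.norm_of_nonneg hn1.le]
  have hnz : ‖((n : ℂ) + 1) * z‖ = (n + 1) * ‖z‖ := by rw [norm_mul, hnorm]
  have hre : 0 ≤ (((n : ℂ) + 1) * z).re := by
    rw [hcast, re_ofReal_mul]; positivity
  rw [norm_div, hnorm]
  calc _ ≤ 7 / ((n + 1) * ‖z‖) / (n + 1 : ℝ) := by
        gcongr
        exact hnz ▸ norm_cdigamma_sub_log_le hre (hnz ▸ hn)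
    _ = _ := by field_simp

lemma cdigamma_neg_sub {w : ℂ} (hw : 0 < w.im) :
    cdigamma (-w) - cdigamma w
      = 1 / w - Real.pi * I
        - 2 * Real.pi * I * (exp (2 * Real.pi * I * w) / (1 - exp (2 * Real.pi * I * w))) := by
  have hw0 : w ≠ 0 := fun h => by simp [h] at hw
  have hnat : ∀ {v : ℂ}, v.im ≠ 0 → ∀ m : ℕ, v ≠ -m := fun hv m h => hv (by simp [h])
  have h1w : (1 - w).im ≠ 0 := by simp [hw.ne']
  have hnw : (-w).im ≠ 0 := by simp [hw.ne']
  have hsin : sin (Real.pi * w) ≠ 0 := by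
    intro h
    obtain ⟨k, hk⟩ := Complex.sin_eq_zero_iff.mp h
    have := congrArg Complex.im hk
    simp [hw.ne', Real.pi_ne_zero] at this
  have hadd : cdigamma (-w + 1) = cdigamma (-w) + (-w)⁻¹ :=
    digamma_apply_add_one (-w) (hnat hnw)
  have hdG : DifferentiableAt ℂ Gamma w := differentiableAt_Gamma w (hnat hw.ne')
  have hdG1 : DifferentiableAt ℂ Gamma (1 - w) := differentiableAt_Gamma _ (hnat h1w)
  have hG : Gamma w ≠ 0 := Gamma_ne_zero (hnat hw.ne')
  have hG1 : Gamma (1 - w) ≠ 0 := Gamma_ne_zero (hnat h1w)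
  have hd1 : HasDerivAt (fun v : ℂ => Gamma (1 - v)) (-deriv Gamma (1 - w)) w := by
    simpa using hdG1.hasDerivAt.comp_const_sub 1 w
  have hds : HasDerivAt (fun v : ℂ => sin (Real.pi * v)) (cos (Real.pi * w) * Real.pi) w := by
    simpa using ((hasDerivAt_id w).const_mul (Real.pi : ℂ)).csin
  have hprod := hdG.hasDerivAt.mul hd1
  have hquot := (hasDerivAt_const w (Real.pi : ℂ)).div hds hsin
  have hfun : (Gamma * fun v : ℂ => Gamma (1 - v))
      = (fun _ => (Real.pi : ℂ)) / fun v : ℂ => sin (Real.pi * v) :=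
    funext Gamma_mul_Gamma_one_sub
  rw [hfun] at hprod
  have hderiv := hprod.unique hquot
  have hrefl := Gamma_mul_Gamma_one_sub w
  have hpsi : cdigamma w - cdigamma (1 - w) = -(Real.pi * cot (Real.pi * w)) := by
    unfold cdigamma
    rw [div_sub_div _ _ hG hG1, hrefl]
    have : deriv Gamma w * Gamma (1 - w) - Gamma w * deriv Gamma (1 - w)
        = deriv Gamma w * Gamma (1 - w) + Gamma w * -deriv Gamma (1 - w) := by ring
    rw [this, hderiv, cot_eq_cos_div_sin]
    have hpi : (Real.pi : ℂ) ≠ 0 := ofReal_ne_zero.mpr Real.pi_ne_zero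
    field_simp
    ring
  have hq : (1 : ℂ) - exp (2 * Real.pi * I * w) ≠ 0 := by
    intro h
    have h1 : ‖exp (2 * Real.pi * I * w)‖ = 1 := by rw [← sub_eq_zero.mp h, norm_one]
    rw [norm_exp, Real.exp_eq_one_iff] at h1
    simp [hw.ne', Real.pi_ne_zero] at h1
  rw [cot_pi_eq_exp_ratio, add_comm (-w), ← sub_eq_add_neg] at *
  have hadd' : cdigamma (-w) = cdigamma (1 - w) + 1 / w := by
    rw [hadd, inv_neg, one_div]; ring
  rw [hadd', ← sub_eq_zero]
  have hexp : cdigamma (1 - w) = cdigamma w + Real.pi * ((exp (2 * Real.pi * I * w) + 1)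
      / (I * (1 - exp (2 * Real.pi * I * w)))) := by
    rw [← sub_eq_iff_eq_add', ← neg_sub, hpsi, neg_neg]
  rw [hexp]
  generalize exp (2 * Real.pi * I * w) = E at hq ⊢
  field_simp
  ring_nf
  rw [I_sq]
  ring

lemma log_neg_of_im_pos {w : ℂ} (hw : 0 < w.im) :
    Complex.log (-w) = Complex.log w - Real.pi * I := by
  simp only [Complex.log, norm_neg, arg_neg_eq_arg_sub_pi_of_im_pos hw]
  push_cast
  ring

lemma hasSum_lambert_neg_log {q : ℂ} (hq : ‖q‖ < 1) :
    HasSum (fun n : ℕ => q ^ (n + 1) / (1 - q ^ (n + 1)) / ((n : ℂ) + 1))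
      (-∑' m : ℕ, Complex.log (1 - q ^ (m + 1))) := by
  have hpow : ∀ m : ℕ, ‖q ^ (m + 1)‖ < 1 := fun m => by
    rw [norm_pow]; exact pow_lt_one₀ (norm_nonneg q) hq m.succ_ne_zero
  have hs : Summable fun p : ℕ × ℕ => q ^ ((p.1 + 1) * (p.2 + 1)) / ((p.1 : ℂ) + 1) := by
    have hgeo := summable_geometric_of_lt_one (norm_nonneg q) hq
    refine Summable.of_norm_bounded (hgeo.mul_of_nonneg hgeo (fun n => by positivity)
      (fun n => by positivity)) fun p => ?_
    have hden : 1 ≤ ‖(p.1 : ℂ) + 1‖ := by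
      have : (p.1 : ℂ) + 1 = ((p.1 + 1 : ℕ) : ℂ) := by push_cast; rfl
      rw [this, norm_natCast]
      exact_mod_cast p.1.succ_pos
    rw [norm_div, norm_pow, ← pow_add]
    refine (div_le_self (by positivity) hden).trans ?_
    exact pow_le_pow_of_le_one (norm_nonneg q) hq.le (by nlinarith)
  have hrow : ∀ n : ℕ, HasSum (fun m : ℕ => q ^ ((n + 1) * (m + 1)) / ((n : ℂ) + 1))
      (q ^ (n + 1) / (1 - q ^ (n + 1)) / ((n : ℂ) + 1)) := by
    intro n
    have := ((hasSum_geometric_of_norm_lt_one (hpow n)).mul_left (q ^ (n + 1))).div_const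
      ((n : ℂ) + 1)
    rw [← div_eq_mul_inv] at this
    refine this.congr_fun ?_
    intro m
    rw [← pow_mul, ← pow_add]
    ring_nf
  have hcol : ∀ m : ℕ, HasSum (fun n : ℕ => q ^ ((n + 1) * (m + 1)) / ((n : ℂ) + 1))
      (-Complex.log (1 - q ^ (m + 1))) := by
    intro m
    have := (hasSum_nat_add_iff' 1).mpr (hasSum_taylorSeries_neg_log (hpow m))
    simp only [Finset.range_one, Finset.sum_singleton, Nat.cast_zero, div_zero, sub_zero,
      Nat.cast_add, Nat.cast_one] at this
    refine this.congr_fun ?_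
    intro n
    rw [← pow_mul, mul_comm]
  have h1 : HasSum _ _ := hs.hasSum.prod_fiberwise hrow
  have h2 : HasSum _ _ := ((Equiv.prodComm ℕ ℕ).hasSum_iff.mpr hs.hasSum).prod_fiberwise hcol
  rw [← tsum_neg, h2.tsum_eq]
  exact h1

lemma hasSum_cherglotzF_neg_sub {z : ℂ} (hz : 0 < z.im) :
    HasSum (fun n : ℕ =>
        (cdigamma (((n : ℂ) + 1) * -z) - Complex.log (((n : ℂ) + 1) * -z)) / ((n : ℂ) + 1)
        - (cdigamma (((n : ℂ) + 1) * z) - Complex.log (((n : ℂ) + 1) * z)) / ((n : ℂ) + 1))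
      ((Real.pi : ℂ) ^ 2 / 6 / z + 2 * Real.pi * I *
        ∑' n : ℕ, Complex.log (1 - exp (2 * Real.pi * I * ((n : ℂ) + 1) * z))) := by
  have hz0 : z ≠ 0 := fun h => by simp [h] at hz
  set q := exp (2 * Real.pi * I * z) with hqdef
  have hq : ‖q‖ < 1 := by
    rw [hqdef, norm_exp, Real.exp_lt_one_iff]
    have : (2 * Real.pi * I * z).re = -(2 * Real.pi * z.im) := by simp
    rw [this]
    have := Real.pi_pos
    simp only [Left.neg_neg_iff]
    positivity
  have hqpow : ∀ n : ℕ, exp (2 * Real.pi * I * ((n : ℂ) + 1) * z) = q ^ (n + 1) := fun n => by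
    rw [hqdef, ← exp_nat_mul]; congr 1; push_cast; ring
  have hzeta : HasSum (fun n : ℕ => 1 / ((n : ℂ) + 1) ^ 2) ((Real.pi : ℂ) ^ 2 / 6) := by
    have := (hasSum_nat_add_iff' 1).mpr hasSum_zeta_two
    have := hasSum_ofReal.mpr this
    simpa using this
  have hL := (hasSum_lambert_neg_log hq).mul_left (2 * Real.pi * I : ℂ)
  have hsum := (hzeta.div_const z).sub hL
  simp only [hqpow]
  rw [mul_neg, sub_neg_eq_add] at hsum
  refine hsum.congr_fun fun n => ?_
  have hn : ((n : ℂ) + 1) ≠ 0 := Nat.cast_add_one_ne_zero n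
  have him : 0 < (((n : ℂ) + 1) * z).im := by
    have : (((n : ℂ) + 1) * z).im = (n + 1) * z.im := by simp
    rw [this]; positivity
  rw [mul_neg, log_neg_of_im_pos him, ← sub_div]
  have h := cdigamma_neg_sub him
  rw [← mul_assoc, hqpow] at h
  rw [sub_eq_iff_eq_add] at h
  rw [h]
  generalize q ^ (n + 1) / (1 - q ^ (n + 1)) = A
  field_simp
  ring

lemma cherglotzF_neg_sub {z : ℂ} (hz : 0 < z.im) :
    cherglotzF (-z) - cherglotzF z = (Real.pi : ℂ) ^ 2 / 6 / z + 2 * Real.pi * I *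
        ∑' n : ℕ, Complex.log (1 - exp (2 * Real.pi * I * ((n : ℂ) + 1) * z)) := by
  have hz0 : z ≠ 0 := fun h => by simp [h] at hz
  have hd := hasSum_cherglotzF_neg_sub hz
  rw [← hd.tsum_eq]
  unfold cherglotzF
  symm
  rcases le_total 0 z.re with h | h
  · have hs := summable_cherglotzF_of_re_nonneg h hz0
    exact ((hd.summable.add hs).congr fun n => by ring).tsum_sub hs
  · have hs := summable_cherglotzF_of_re_nonneg (z := -z) (by simpa using h) (neg_ne_zero.mpr hz0)
    exact hs.tsum_sub ((hs.sub hd.summable).congr fun n => by ring)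

lemma log_div_I_of_im_pos {z : ℂ} (hz : 0 < z.im) :
    Complex.log (z / I) = Complex.log z - Real.pi / 2 * I := by
  have hz0 : z ≠ 0 := fun h => by simp [h] at hz
  have h0 : 0 ≤ z.arg := arg_nonneg_iff.mpr hz.le
  have hpi := arg_le_pi z
  have := Real.pi_pos
  rw [div_I, ← mul_neg, Complex.log_mul hz0 (neg_ne_zero.mpr I_ne_zero), log_neg_I]
  · ring
  · rw [arg_neg_I]; constructor <;> linarith

theorem cmathcalF_eta_relation (z : ℂ) (hz : 0 < z.im) :
    cmathcalF (-z) - cmathcalF z =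
      2 * (Real.pi : ℂ) * Complex.I *
        ((1 / 4) * Complex.log (z / Complex.I) + (Real.pi : ℂ) * Complex.I * z / 12
          + ∑' n : ℕ,
              Complex.log (1 - Complex.exp (2 * (Real.pi : ℂ) * Complex.I * ((n : ℂ) + 1) * z))) := by
  have hz0 : z ≠ 0 := fun h => by simp [h] at hz
  have h := sub_eq_iff_eq_add.mp (cherglotzF_neg_sub hz)
  unfold cmathcalF
  rw [h, log_neg_of_im_pos hz, log_div_I_of_im_pos hz]
  have hinv : 1 / -z = -(1 / z) := by rw [div_neg]
  rw [hinv]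
  generalize (∑' n : ℕ, Complex.log (1 - exp (2 * Real.pi * I * ((n : ℂ) + 1) * z))) = S
  linear_combination (-(Real.pi : ℂ) ^ 2 * z / 6) * I_sq
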